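/- Let E be a real inner product space and ℒ : E → ℝ differentiable with L-Lipschitz gradient. Fix η > 0, c ≥ 0, β ∈ [0,1), and positive constants ε₁, ε₂, ε₃. Consider the deterministic perturbed momentum update v' = β·v + (1−β)·g with g = ∇ℒ(θ) + ζ, and θ' = θ − η·v', where ζ ∈ E is an arbitrary perturbation. Define Ψ(θ, v) = ℒ(θ) + c‖v‖² and the constants α = η(1−β)·(1 − ε₂ − β/(4ε₁(1−β)) − (2/η)(η²L/2 + c)(1−β + β/(4ε₁))), C₁ = η·β·ε₁ + (η²L/2 + c)·β·(β + 2(1−β)(ε₁ + ε₃)) − c, and C₂ = η(1−β)/(4ε₂) + 2(η²L/2 + c)(1−β)·((1−β) + β/(4ε₃)). Then Ψ(θ', v') − Ψ(θ, v) ≤ −α·‖∇ℒ(θ)‖² + C₁·‖v‖² + C₂·‖ζ‖². -/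

import Mathlib

/-- The quadratic upper bound for a function whose gradient is `L`-Lipschitz. -/
theorem le_add_inner_add_sq_of_lipschitz_gradient {E : Type*}
    [NormedAddCommGroup E] [InnerProductSpace ℝ E] {f : E → ℝ} {g : E → E} {L : ℝ}
    (hgrad : ∀ x, HasFDerivAt f (innerSL ℝ (g x)) x)
    (hLip : ∀ x y, ‖g x - g y‖ ≤ L * ‖x - y‖) (x d : E) :
    f (x + d) ≤ f x + inner ℝ (g x) d + L / 2 * ‖d‖ ^ 2 := by
  let φ : ℝ → ℝ := fun t => f (x + t • d) - t * inner ℝ (g x) d - t ^ 2 * (L / 2 * ‖d‖ ^ 2)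
  have hφ (t : ℝ) : HasDerivAt φ
      (inner ℝ (g (x + t • d)) d - inner ℝ (g x) d - 2 * t * (L / 2 * ‖d‖ ^ 2)) t := by
    have hline : HasDerivAt (fun t : ℝ => x + t • d) d t := by
      simpa using ((hasDerivAt_id t).smul_const d).const_add x
    have hf : HasDerivAt (fun t : ℝ => f (x + t • d)) (inner ℝ (g (x + t • d)) d) t := by
      exact (hgrad (x + t • d)).comp_hasDerivAt t hline
    have hlin : HasDerivAt (fun t : ℝ => t * inner ℝ (g x) d) (inner ℝ (g x) d) t := by
      simpa using (hasDerivAt_id t).mul_const (inner ℝ (g x) d)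
    have hsq : HasDerivAt (fun t : ℝ => t ^ 2 * (L / 2 * ‖d‖ ^ 2))
        (2 * t * (L / 2 * ‖d‖ ^ 2)) t := by
      simpa using (hasDerivAt_pow 2 t).mul_const (L / 2 * ‖d‖ ^ 2)
    exact (hf.sub hlin).sub hsq
  have hanti : AntitoneOn φ (Set.Icc 0 1) := by
    refine antitoneOn_of_deriv_nonpos (convex_Icc 0 1)
      (fun t _ => (hφ t).continuousAt.continuousWithinAt)
      (fun t _ => (hφ t).differentiableAt.differentiableWithinAt) fun t ht => ?_
    rw [interior_Icc] at ht
    rw [(hφ t).deriv, ← inner_sub_left]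
    have hg : ‖g (x + t • d) - g x‖ ≤ L * (t * ‖d‖) := by
      simpa [norm_smul, abs_of_pos ht.1] using hLip (x + t • d) x
    have hinner := (real_inner_le_norm (g (x + t • d) - g x) d).trans
      (mul_le_mul_of_nonneg_right hg (norm_nonneg d))
    linarith
  have h := hanti (Set.left_mem_Icc.2 zero_le_one) (Set.right_mem_Icc.2 zero_le_one) zero_le_one
  simp only [φ, one_smul, zero_smul, add_zero] at h
  linarith

/-- Young's inequality for the inner product, with a free parameter `ε`. -/
theorem abs_real_inner_le_mul_sq_add_sq_div {E : Type*}
    [NormedAddCommGroup E] [InnerProductSpace ℝ E] {ε : ℝ} (hε : 0 < ε) (x y : E) :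
    |inner ℝ x y| ≤ ε * ‖x‖ ^ 2 + ‖y‖ ^ 2 / (4 * ε) := by
  refine (abs_real_inner_le_norm x y).trans ?_
  have h : ε * ‖x‖ ^ 2 + ‖y‖ ^ 2 / (4 * ε) - ‖x‖ * ‖y‖ =
      (2 * ε * ‖x‖ - ‖y‖) ^ 2 / (4 * ε) := by
    field_simp
    ring
  have : 0 ≤ (2 * ε * ‖x‖ - ‖y‖) ^ 2 / (4 * ε) := by positivity
  linarith


/-- **Deterministic one-step descent inequality for perturbed momentum SGD.**
For an `L`-smooth loss `ℒ` with gradient map `g` (i.e. `Dℒ(x) = ⟪g x, ·⟫` and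
`g` is `L`-Lipschitz), learning rate `η > 0`, `c ≥ 0`, momentum `β ∈ [0,1)`,
Young parameters `ε₁, ε₂, ε₃ > 0`, perturbed gradient signal `g θ + ζ`,
momentum update `v' = β • v + (1-β) • (g θ + ζ)`, parameter update
`θ' = θ - η • v'`, and Lyapunov function `Ψ θ v = ℒ θ + c‖v‖²`, the constants
`α`, `C₁`, `C₂` of the paper satisfy
`Ψ θ' v' - Ψ θ v ≤ -α‖g θ‖² + C₁‖v‖² + C₂‖ζ‖²`. -/
theorem perturbed_momentum_one_step {E : Type*}
    [NormedAddCommGroup E] [InnerProductSpace ℝ E]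
    (ℒ : E → ℝ) (g : E → E) (L : ℝ)
    (hgrad : ∀ x, HasFDerivAt ℒ (innerSL ℝ (g x)) x)
    (hLip : ∀ x y, ‖g x - g y‖ ≤ L * ‖x - y‖)
    (η c β ε₁ ε₂ ε₃ : ℝ) (hη : 0 < η) (hc : 0 ≤ c) (hβ : β ∈ Set.Ico (0 : ℝ) 1)
    (hε₁ : 0 < ε₁) (hε₂ : 0 < ε₂) (hε₃ : 0 < ε₃)
    (Ψ : E → E → ℝ) (hΨ : ∀ θ v, Ψ θ v = ℒ θ + c * ‖v‖ ^ 2)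
    (θ v ζ v' θ' : E)
    (hv' : v' = β • v + (1 - β) • (g θ + ζ))
    (hθ' : θ' = θ - η • v')
    (α C₁ C₂ : ℝ)
    (hα : α = η * (1 - β) * (1 - ε₂ - β / (4 * ε₁ * (1 - β)) -
      (2 / η) * (η ^ 2 * L / 2 + c) * (1 - β + β / (4 * ε₁))))
    (hC₁ : C₁ = η * β * ε₁ +
      (η ^ 2 * L / 2 + c) * β * (β + 2 * (1 - β) * (ε₁ + ε₃)) - c)
    (hC₂ : C₂ = η * (1 - β) / (4 * ε₂) +
      2 * (η ^ 2 * L / 2 + c) * (1 - β) * ((1 - β) + β / (4 * ε₃))) :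
    Ψ θ' v' - Ψ θ v ≤ -α * ‖g θ‖ ^ 2 + C₁ * ‖v‖ ^ 2 + C₂ * ‖ζ‖ ^ 2 := by
  obtain ⟨hβ0, hβ1⟩ := hβ
  have hβ' : 0 < 1 - β := sub_pos.2 hβ1
  obtain _ | _ := subsingleton_or_nontrivial E
  · rw [Subsingleton.elim θ' θ, Subsingleton.elim v' v]
    simp [Subsingleton.elim (g θ) 0, Subsingleton.elim v 0, Subsingleton.elim ζ 0]
  have hL : 0 ≤ L := by
    obtain ⟨x, hx⟩ := exists_ne (0 : E)
    have h := (norm_nonneg _).trans (hLip x 0)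
    rw [sub_zero] at h
    exact nonneg_of_mul_nonneg_left h (norm_pos_iff.2 hx)
  have hdesc : ℒ θ' ≤ ℒ θ - η * inner ℝ (g θ) v' + L / 2 * (η ^ 2 * ‖v'‖ ^ 2) := by
    have h := le_add_inner_add_sq_of_lipschitz_gradient hgrad hLip θ (-(η • v'))
    rwa [← sub_eq_add_neg, ← hθ', inner_neg_right, real_inner_smul_right, norm_neg, norm_smul,
      mul_pow, Real.norm_eq_abs, sq_abs, ← sub_eq_add_neg] at h
  have hinner : inner ℝ (g θ) v' =
      β * inner ℝ v (g θ) + (1 - β) * (‖g θ‖ ^ 2 + inner ℝ (g θ) ζ) := by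
    rw [hv', inner_add_right, real_inner_smul_right, real_inner_smul_right, inner_add_right,
      real_inner_self_eq_norm_sq, real_inner_comm]
  have hnorm : ‖v'‖ ^ 2 = β ^ 2 * ‖v‖ ^ 2 +
      2 * (β * (1 - β)) * (inner ℝ v (g θ) + inner ℝ v ζ) + (1 - β) ^ 2 * ‖g θ + ζ‖ ^ 2 := by
    rw [hv', norm_add_sq_real, norm_smul, norm_smul, mul_pow, mul_pow, Real.norm_eq_abs,
      Real.norm_eq_abs, sq_abs, sq_abs, real_inner_smul_left, real_inner_smul_right,
      inner_add_right]
    ring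
  have hadd : ‖g θ + ζ‖ ^ 2 ≤ 2 * ‖g θ‖ ^ 2 + 2 * ‖ζ‖ ^ 2 := by
    linarith [parallelogram_law_with_norm ℝ (g θ) ζ, mul_self_nonneg ‖g θ - ζ‖]
  have hvg := abs_le.1 (abs_real_inner_le_mul_sq_add_sq_div hε₁ v (g θ))
  have hgζ := abs_le.1 (abs_real_inner_le_mul_sq_add_sq_div hε₂ (g θ) ζ)
  have hvζ := abs_le.1 (abs_real_inner_le_mul_sq_add_sq_div hε₃ v ζ)
  have hK : 0 ≤ η ^ 2 * L / 2 + c := by positivity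
  have hdrift : -(η * inner ℝ (g θ) v') ≤
      η * β * (ε₁ * ‖v‖ ^ 2 + ‖g θ‖ ^ 2 / (4 * ε₁)) - η * (1 - β) * ‖g θ‖ ^ 2 +
        η * (1 - β) * (ε₂ * ‖g θ‖ ^ 2 + ‖ζ‖ ^ 2 / (4 * ε₂)) := by
    have h₁ := mul_le_mul_of_nonneg_left hvg.1 (mul_nonneg hη.le hβ0)
    have h₂ := mul_le_mul_of_nonneg_left hgζ.1 (mul_pos hη hβ').le
    rw [hinner]
    linarith
  have hmomentum : ‖v'‖ ^ 2 ≤ β ^ 2 * ‖v‖ ^ 2 + 2 * (β * (1 - β)) *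
      ((ε₁ * ‖v‖ ^ 2 + ‖g θ‖ ^ 2 / (4 * ε₁)) + (ε₃ * ‖v‖ ^ 2 + ‖ζ‖ ^ 2 / (4 * ε₃))) +
        (1 - β) ^ 2 * (2 * ‖g θ‖ ^ 2 + 2 * ‖ζ‖ ^ 2) := by
    rw [hnorm]
    gcongr
    exacts [hvg.2, hvζ.2]
  have hKv := mul_le_mul_of_nonneg_left hmomentum hK
  have hα' : α = η * (1 - β) - η * (1 - β) * ε₂ - η * β / (4 * ε₁) -
      2 * (η ^ 2 * L / 2 + c) * (1 - β) * (1 - β + β / (4 * ε₁)) := by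
    rw [hα]
    field_simp
  rw [hΨ, hΨ, hα', hC₁, hC₂]
  refine le_trans (b := -(η * inner ℝ (g θ) v') + (η ^ 2 * L / 2 + c) * ‖v'‖ ^ 2 - c * ‖v‖ ^ 2)
    (by linarith) ((sub_le_sub_right (add_le_add hdrift hKv) _).trans_eq ?_)
  ring
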